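/- Let q be a power of a prime p and 𝔽_q the field with q elements. Let F be a field equipped with a nontrivial nonarchimedean multiplicative absolute value ‖·‖ with respect to which F is complete, and suppose F is an 𝔽_q-algebra. Let y ∈ F with ‖y‖ > 1, let r ≥ 1 be an integer, let n be a natural number, let n_2, …, n_r ∈ ℤ, and let z_2, …, z_r ∈ F. If d_1 is a natural number with d_1(q − 1) > ℓ_q(n), then the finite sum over all r-tuples (a_1, …, a_r) of monic polynomials in 𝔽_q[X] with deg a_1 = d_1 > deg a_2 > ⋯ > deg a_r ≥ 0 of a_1(y)^{n} · ∏_{i=2}^r a_i(y)^{−n_i} · z_i^{deg a_i} equals 0. (This gives the degree bound deg_{z_1} Z((−n, n_2, …, n_r); z) ≤ ℓ_q(n)/(q − 1) for the multiple twisted zeta function with non-positive first weight.) -/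

import Mathlib

open Polynomial in
/-- Monic polynomials of degree `d` are parametrised by their lower coefficients. -/
theorem bijOn_monic_natDegree_eq (K : Type*) [Field K] (d : ℕ) :
    Set.BijOn (fun c : Fin d → K => X ^ d + ∑ j : Fin d, C (c j) * X ^ (j : ℕ)) Set.univ
      {a : K[X] | a.Monic ∧ a.natDegree = d} := by
  refine ⟨fun c _ => ?_, fun c _ c' _ h => ?_, fun a ha => ⟨fun j => a.coeff j, trivial, ?_⟩⟩
  · have hlt := degree_sum_fin_lt c
    exact ⟨monic_X_pow_add hlt, natDegree_eq_of_degree_eq_some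
      ((degree_add_eq_left_of_degree_lt (by rwa [degree_X_pow])).trans (degree_X_pow d))⟩
  · funext i
    have := congrArg (fun p => coeff p (i : ℕ)) (add_left_cancel h)
    simpa [finsetSum_coeff, coeff_C_mul, coeff_X_pow, Fin.val_inj] using this
  · obtain ⟨hm, rfl⟩ := ha
    conv_rhs => rw [hm.as_sum]
    rw [Finset.sum_range]

open Polynomial in
/-- There are finitely many monic polynomials of bounded degree over a finite field. -/
theorem finite_monic_natDegree_lt (K : Type*) [Field K] [Finite K] (d : ℕ) :
    {a : K[X] | a.Monic ∧ a.natDegree < d}.Finite := by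
  have h : {a : K[X] | a.Monic ∧ a.natDegree < d} ⊆
      ⋃ e ∈ Set.Iio d, {a : K[X] | a.Monic ∧ a.natDegree = e} := by
    rintro a ⟨hm, hd⟩
    simp [hm, hd]
  refine ((Set.finite_Iio d).biUnion fun e _ => ?_).subset h
  exact (bijOn_monic_natDegree_eq K e).image_eq ▸ Set.finite_univ.image _

/-- A polynomial over an extension of a finite field `K`, of total degree less than
`(#K - 1) * #σ`, sums to zero over the `K`-rational points. -/
theorem MvPolynomial.sum_eval_algebraMap_eq_zero {K F σ : Type*} [Field K] [Fintype K]
    [CommRing F] [Algebra K F] [Fintype σ] [DecidableEq σ] (P : MvPolynomial σ F)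
    (hP : P.totalDegree < (Fintype.card K - 1) * Fintype.card σ) :
    ∑ c : σ → K, MvPolynomial.eval (fun j => algebraMap K F (c j)) P = 0 := by
  simp_rw [MvPolynomial.eval_eq']
  rw [Finset.sum_comm]
  refine Finset.sum_eq_zero fun m hm => ?_
  rw [← Finset.mul_sum]
  have hmon : (MvPolynomial.monomial m (1 : K)).totalDegree <
      (Fintype.card K - 1) * Fintype.card σ := by
    rw [MvPolynomial.totalDegree_monomial _ one_ne_zero]
    exact (MvPolynomial.le_totalDegree hm).trans_lt hP
  have h := congrArg (algebraMap K F) (MvPolynomial.sum_eval_eq_zero _ hmon)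
  simp only [MvPolynomial.eval_monomial, one_mul, map_sum, map_zero] at h
  simp only [Finsupp.prod_fintype _ _ (fun _ => pow_zero _), map_prod, map_pow] at h
  rw [h, mul_zero]

open Polynomial in
/-- The power `a(v) ^ n` of the value of a monic polynomial `a` is a polynomial in the lower
coefficients of `a`, of total degree at most the sum of the digits of `n` in base `#K`. -/
theorem exists_mvPolynomial_aeval_pow_ofDigits {K F : Type*} [Field K] [Fintype K] [CommRing F]
    [Algebra K F] (d : ℕ) (L : List ℕ) (v : F) :
    ∃ P : MvPolynomial (Fin d) F, P.totalDegree ≤ L.sum ∧ ∀ c : Fin d → K,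
      MvPolynomial.eval (fun j => algebraMap K F (c j)) P =
        aeval v (X ^ d + ∑ j : Fin d, C (c j) * X ^ (j : ℕ)) ^
          Nat.ofDigits (Fintype.card K) L := by
  induction L generalizing v with
  | nil => exact ⟨1, by simp, fun c => by simp⟩
  | cons b L ih =>
    obtain ⟨P, hP, hPe⟩ := ih (v ^ Fintype.card K)
    let Q : MvPolynomial (Fin d) F :=
      MvPolynomial.C (v ^ d) + ∑ j : Fin d, MvPolynomial.C (v ^ (j : ℕ)) * MvPolynomial.X j
    have hQ : Q.totalDegree ≤ 1 := by
      refine (MvPolynomial.totalDegree_add _ _).trans (max_le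
        ((MvPolynomial.totalDegree_C _).trans_le zero_le_one) ?_)
      refine MvPolynomial.totalDegree_finsetSum_le fun j _ => ?_
      rw [MvPolynomial.X, MvPolynomial.C_mul_monomial]
      exact (MvPolynomial.totalDegree_monomial_le _ _).trans (by simp)
    refine ⟨Q ^ b * P, ?_, fun c => ?_⟩
    · rw [List.sum_cons]
      refine (MvPolynomial.totalDegree_mul _ _).trans (add_le_add ?_ hP)
      exact (MvPolynomial.totalDegree_pow _ _).trans ((Nat.mul_le_mul_left b hQ).trans_eq (mul_one b))
    · have hfrob (a : K[X]) : aeval (v ^ Fintype.card K) a = aeval v a ^ Fintype.card K := by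
        rw [← map_pow, ← FiniteField.expand_card, expand_aeval]
      have hQe : MvPolynomial.eval (fun j => algebraMap K F (c j)) Q =
          aeval v (X ^ d + ∑ j : Fin d, C (c j) * X ^ (j : ℕ)) := by
        simp only [Q, map_add, map_sum, map_mul, map_pow, MvPolynomial.eval_C,
          MvPolynomial.eval_X, aeval_X, aeval_C, mul_comm]
      rw [map_mul, map_pow, hPe, hQe, hfrob, Nat.ofDigits_cons, pow_add, pow_mul]

open Polynomial in
/-- Vanishing of power sums of monic polynomials of degree `d` with small digit sum. -/
theorem finsum_monic_aeval_pow_eq_zero {K F : Type*} [Field K] [Fintype K] [CommRing F]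
    [Algebra K F] (v : F) (n d : ℕ)
    (h : (Nat.digits (Fintype.card K) n).sum < d * (Fintype.card K - 1)) :
    ∑ᶠ a ∈ {a : K[X] | a.Monic ∧ a.natDegree = d}, aeval v a ^ n = 0 := by
  obtain ⟨P, hP, hPe⟩ := exists_mvPolynomial_aeval_pow_ofDigits (K := K) d
    (Nat.digits (Fintype.card K) n) v
  simp only [Nat.ofDigits_digits] at hPe
  rw [← finsum_mem_eq_of_bijOn _ (bijOn_monic_natDegree_eq K d) (fun c _ => hPe c),
    finsum_mem_univ, finsum_eq_sum_of_fintype]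
  refine MvPolynomial.sum_eval_algebraMap_eq_zero P ?_
  rw [Fintype.card_fin, mul_comm]
  exact hP.trans_lt h


/-- Let `F` be a complete nontrivially valued nonarchimedean field
which is an `𝔽_q`-algebra, `y ∈ F` with `‖y‖ > 1`, `r ≥ 1` (here `r = r' + 1`),
`nn ∈ ℕ`, `n₂,…,n_r ∈ ℤ` and `z₂,…,z_r ∈ F`. If `d₁ (q - 1) > ℓ_q(nn)`, then the
finite sum over tuples `(a₁,…,a_r)` of monic polynomials with
`deg a₁ = d₁ > deg a₂ > ⋯ > deg a_r ≥ 0` of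
`a₁(y)^{nn} · ∏_{i=2}^r a_i(y)^{-n_i} z_i^{deg a_i}` vanishes: the coefficient of
`z₁^{d₁}` in the multiple twisted zeta function with first weight `-nn` is zero for
`d₁ > ℓ_q(nn)/(q-1)`. -/
theorem stmt_19 (p f q : ℕ) (hp : p.Prime) (hf : 0 < f) (hq : q = p ^ f)
    (Fq : Type*) [Field Fq] [Fintype Fq] (hcard : Fintype.card Fq = q)
    (F : Type*) [NontriviallyNormedField F] [CompleteSpace F] [IsUltrametricDist F]
    [Algebra Fq F]
    (y : F) (hy : 1 < ‖y‖)
    (r : ℕ) (nn : ℕ) (n : Fin r → ℤ) (z : Fin r → F)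
    (d1 : ℕ) (hd1 : (Nat.digits q nn).sum < d1 * (q - 1)) :
    ∑ᶠ a ∈ {a : Fin (r + 1) → Polynomial Fq |
        (∀ i, (a i).Monic) ∧ (a 0).natDegree = d1 ∧
        ∀ i j : Fin (r + 1), i < j → (a j).natDegree < (a i).natDegree},
      ((Polynomial.aeval y (a 0)) ^ nn *
        ∏ i : Fin r, ((Polynomial.aeval y (a i.succ)) ^ (-(n i)) *
          (z i) ^ ((a i.succ).natDegree))) = 0 := by
  subst hcard
  have hfin : {b : Fin r → Polynomial Fq | (∀ i, (b i).Monic ∧ (b i).natDegree < d1) ∧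
      ∀ i j, i < j → (b j).natDegree < (b i).natDegree}.Finite :=
    (Set.Finite.pi' fun _ => finite_monic_natDegree_lt Fq d1).subset fun b hb => hb.1
  have hfin₀ : {a : Polynomial Fq | a.Monic ∧ a.natDegree = d1}.Finite :=
    (finite_monic_natDegree_lt Fq (d1 + 1)).subset fun a ha => ⟨ha.1, by have := ha.2; omega⟩
  have hzero := finsum_monic_aeval_pow_eq_zero (K := Fq) y nn d1 hd1
  rw [finsum_mem_eq_finite_toFinset_sum _ hfin₀] at hzero
  let g : Polynomial Fq × (Fin r → Polynomial Fq) → F := fun x =>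
    (Polynomial.aeval y x.1) ^ nn *
      ∏ i : Fin r, ((Polynomial.aeval y (x.2 i)) ^ (-(n i)) * (z i) ^ ((x.2 i).natDegree))
  have hbij : Set.BijOn (fun x : Polynomial Fq × (Fin r → Polynomial Fq) =>
      (Fin.cons x.1 x.2 : Fin (r + 1) → Polynomial Fq))
      ↑(hfin₀.toFinset ×ˢ hfin.toFinset)
      {a : Fin (r + 1) → Polynomial Fq |
        (∀ i, (a i).Monic) ∧ (a 0).natDegree = d1 ∧
        ∀ i j : Fin (r + 1), i < j → (a j).natDegree < (a i).natDegree} := by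
    refine ⟨?_, ?_, ?_⟩
    · rintro ⟨a, b⟩ hab
      simp only [Finset.coe_product, Set.Finite.coe_toFinset, Set.mem_prod,
        Set.mem_ofPred_eq] at hab
      obtain ⟨⟨ham, had⟩, hb, hlt⟩ := hab
      refine ⟨Fin.cases ham fun i => (hb i).1, had, ?_⟩
      refine Fin.cases (Fin.cases (by simp) fun j _ => ?_)
        fun i => Fin.cases (by simp) fun j hij => ?_
      · simpa [had] using (hb j).2
      · simpa using hlt i j (Fin.succ_lt_succ_iff.mp hij)
    · rintro ⟨a, b⟩ _ ⟨a', b'⟩ _ h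
      obtain ⟨h₁, h₂⟩ := Fin.cons_inj.mp h
      exact Prod.ext h₁ h₂
    · rintro a ⟨hm, hd, hlt⟩
      refine ⟨(a 0, Fin.tail a), ?_, Fin.cons_self_tail a⟩
      simp only [Finset.coe_product, Set.Finite.coe_toFinset, Set.mem_prod, Set.mem_ofPred_eq]
      exact ⟨⟨hm 0, hd⟩, fun i => ⟨hm _, hd ▸ hlt 0 i.succ i.succ_pos⟩,
        fun i j hij => hlt _ _ (Fin.succ_lt_succ_iff.mpr hij)⟩
  rw [← finsum_mem_eq_of_bijOn (f := g) _ hbij (fun x _ => by simp [g]),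
    finsum_mem_coe_finset, Finset.sum_product_right]
  refine Finset.sum_eq_zero fun b _ => ?_
  simp only [g]
  rw [← Finset.sum_mul, hzero, zero_mul]
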